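/- Let Q be an upper-connected poset (every pair of elements of Q has an upper bound in Q), and let U, U′ ⊆ Q be upsets with U′ nonempty. Then Hom_Q(k[U′], k[U]) is a one-dimensional k-vector space if U′ ⊆ U, and is zero otherwise. -/

import Mathlib

/-- The component of the indicator module `k[S]` in degree `q`: the field `k`
(as the full submodule of itself) if `q ∈ S`, and `0` otherwise. -/
noncomputable def cmpt (k : Type) [Field k] {Q : Type} (S : Set Q) (q : Q) : Submodule k k :=
  haveI := Classical.dec (q ∈ S)
  if q ∈ S then ⊤ else ⊥

/-- The structure map of the indicator module `k[S]` for `q ≤ q'`: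
the identity of `k` when `q, q' ∈ S`, and `0` otherwise. -/
noncomputable def stMap (k : Type) [Field k] {Q : Type} [PartialOrder Q] (S : Set Q)
    {q q' : Q} (h : q ≤ q') : ↥(cmpt k S q) →ₗ[k] ↥(cmpt k S q') :=
  haveI := Classical.dec (q ∈ S ∧ q' ∈ S)
  if hq : q ∈ S ∧ q' ∈ S then
    Submodule.inclusion (by simp [cmpt, hq.1, hq.2])
  else 0

/-- The space of `Q`-module homomorphisms `k[S] → k[T]` between indicator modules:
families of linear maps in each degree commuting with the structure maps. -/
noncomputable def HomQ (k : Type) [Field k] {Q : Type} [PartialOrder Q] (S T : Set Q) :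
    Submodule k (∀ q : Q, ↥(cmpt k S q) →ₗ[k] ↥(cmpt k T q)) where
  carrier := {φ | ∀ (q q' : Q) (h : q ≤ q'), stMap k T h ∘ₗ φ q = φ q' ∘ₗ stMap k S h}
  add_mem' := by
    intro a b ha hb
    simp only [Set.mem_setOf_eq] at ha hb ⊢
    intro q q' h
    ext x
    have ha' := congrArg (fun g => g x) (ha q q' h)
    have hb' := congrArg (fun g => g x) (hb q q' h)
    simp only [LinearMap.comp_apply] at ha' hb' ⊢
    simp only [Pi.add_apply, LinearMap.add_apply, map_add, ha', hb']
  zero_mem' := by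
    simp only [Set.mem_setOf_eq]
    intro q q' h
    ext x
    simp
  smul_mem' := by
    intro c a ha
    simp only [Set.mem_setOf_eq] at ha ⊢
    intro q q' h
    ext x
    have ha' := congrArg (fun g => g x) (ha q q' h)
    simp only [LinearMap.comp_apply] at ha' ⊢
    simp only [Pi.smul_apply, LinearMap.smul_apply, map_smul, ha']

/-- The scalar by which a homomorphism of indicator modules acts in degree `q`. -/
noncomputable def scl {k : Type} [Field k] {Q : Type} {S T : Set Q}
    (φ : ∀ q : Q, ↥(cmpt k S q) →ₗ[k] ↥(cmpt k T q)) (q : Q) (hq : q ∈ S) : k :=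
  (φ q ⟨1, by simp [cmpt, hq]⟩ : ↥(cmpt k T q)).1

/-- The set of connected components of a subset `S` of a poset: the quotient of `S`
by the equivalence relation generated by comparability (zigzag paths within `S`). -/
def Pi0 {Q : Type} [PartialOrder Q] (S : Set Q) : Type :=
  Quot (fun a b : S => (a : Q) ≤ (b : Q))

theorem coe_eq_zero_of_notMem {k : Type} [Field k] {Q : Type} {S : Set Q} {q : Q}
    (hq : q ∉ S) (x : ↥(cmpt k S q)) : (x : k) = 0 := by
  obtain ⟨x, hx⟩ := x
  simpa [cmpt, hq] using hx

theorem cmpt_mono (k : Type) [Field k] {Q : Type} {S T : Set Q} (h : S ⊆ T) (q : Q) :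
    cmpt k S q ≤ cmpt k T q := by
  by_cases hq : q ∈ S
  · simp [cmpt, h hq]
  · simp [cmpt, hq]

/-- For an upset, the structure maps preserve the underlying scalars. -/
theorem IsUpperSet.coe_stMap {k : Type} [Field k] {Q : Type} [PartialOrder Q] {S : Set Q}
    (hS : IsUpperSet S) {q q' : Q} (h : q ≤ q') (x : ↥(cmpt k S q)) :
    (stMap k S h x : k) = x := by
  by_cases hq : q ∈ S
  · have hq' : q ∈ S ∧ q' ∈ S := ⟨hq, hS h hq⟩
    simp [stMap, hq']
  · simp [stMap, hq, coe_eq_zero_of_notMem hq x]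

theorem scl_eq_of_le {k : Type} [Field k] {Q : Type} [PartialOrder Q] {S T : Set Q}
    (hS : IsUpperSet S) (hT : IsUpperSet T)
    {φ : ∀ q : Q, ↥(cmpt k S q) →ₗ[k] ↥(cmpt k T q)} (hφ : φ ∈ HomQ k S T)
    {q q' : Q} (h : q ≤ q') (hq : q ∈ S) : scl φ q' (hS h hq) = scl φ q hq := by
  have h1 : (1 : k) ∈ cmpt k S q := by simp [cmpt, hq]
  have key := congrArg Subtype.val (LinearMap.congr_fun (hφ q q' h) ⟨1, h1⟩)
  simp only [LinearMap.comp_apply] at key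
  rw [hT.coe_stMap] at key
  have hst : stMap k S h ⟨1, h1⟩ = ⟨1, by simp [cmpt, hS h hq]⟩ :=
    Subtype.ext (hS.coe_stMap h _)
  rw [hst] at key
  exact key.symm

/-- Over an upper-connected poset, a homomorphism of upset modules acts by a single scalar. -/
theorem scl_eq_scl {k : Type} [Field k] {Q : Type} [PartialOrder Q]
    (hQ : ∀ a b : Q, ∃ c : Q, a ≤ c ∧ b ≤ c) {S T : Set Q}
    (hS : IsUpperSet S) (hT : IsUpperSet T)
    {φ : ∀ q : Q, ↥(cmpt k S q) →ₗ[k] ↥(cmpt k T q)} (hφ : φ ∈ HomQ k S T)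
    {a b : Q} (ha : a ∈ S) (hb : b ∈ S) : scl φ a ha = scl φ b hb := by
  obtain ⟨c, hac, hbc⟩ := hQ a b
  rw [← scl_eq_of_le hS hT hφ hac ha, ← scl_eq_of_le hS hT hφ hbc hb]

theorem coe_apply_eq_mul_scl {k : Type} [Field k] {Q : Type} {S T : Set Q}
    (φ : ∀ q : Q, ↥(cmpt k S q) →ₗ[k] ↥(cmpt k T q)) {q : Q} (hq : q ∈ S)
    (x : ↥(cmpt k S q)) : (φ q x : k) = x * scl φ q hq := by
  have hx : x = (x : k) • (⟨1, by simp [cmpt, hq]⟩ : ↥(cmpt k S q)) := by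
    ext
    simp
  conv_lhs => rw [hx, map_smul]
  rfl

/-- The canonical homomorphism `k[S] → k[T]` for upsets `S ⊆ T`. -/
noncomputable def inclHom (k : Type) [Field k] {Q : Type} [PartialOrder Q] {S T : Set Q}
    (hS : IsUpperSet S) (hT : IsUpperSet T) (h : S ⊆ T) : ↥(HomQ k S T) :=
  ⟨fun q => Submodule.inclusion (cmpt_mono k h q), fun q q' hqq' => by
    ext x
    simp [hS.coe_stMap, hT.coe_stMap]⟩

/-- Let `Q` be an upper-connected poset (every pair of elements has an
upper bound) and let `U', U` be upsets of `Q` with `U'` nonempty.  Then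
`Hom_Q(k[U'], k[U])` is one-dimensional if `U' ⊆ U` and is zero otherwise. -/
theorem hom_upset_upset_upper_connected (k : Type) [Field k] (Q : Type) [PartialOrder Q]
    (hQ : ∀ a b : Q, ∃ c : Q, a ≤ c ∧ b ≤ c)
    (U' U : Set Q) (hU' : IsUpperSet U') (hU : IsUpperSet U) (hne : U'.Nonempty) :
    (U' ⊆ U → Module.rank k ↥(HomQ k U' U) = 1) ∧
    (¬ U' ⊆ U → HomQ k U' U = ⊥) := by
  obtain ⟨a, ha⟩ := hne
  refine ⟨fun h => ?_, fun h => ?_⟩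
  · have h1 : scl (inclHom k hU' hU h).1 a ha = 1 := rfl
    have hsmul (r : k) : scl (r • inclHom k hU' hU h).1 a ha = r := by
      change r * scl (inclHom k hU' hU h).1 a ha = r
      rw [h1, mul_one]
    suffices hb : Function.Bijective (LinearMap.toSpanSingleton k _ (inclHom k hU' hU h)) from
      (LinearEquiv.ofBijective _ hb).rank_eq.symm.trans (Module.rank_self k)
    refine ⟨fun r s hrs => ?_, fun φ => ⟨scl φ.1 a ha, ?_⟩⟩
    · rw [← hsmul r, ← hsmul s]
      exact congrArg (fun φ : ↥(HomQ k U' U) => scl φ.1 a ha) hrs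
    · refine Subtype.ext (funext fun q => LinearMap.ext fun x => Subtype.ext ?_)
      by_cases hq : q ∈ U'
      · rw [coe_apply_eq_mul_scl φ.1 hq, scl_eq_scl hQ hU' hU φ.2 hq ha, mul_comm]
        rfl
      · obtain rfl : x = 0 := Subtype.ext (coe_eq_zero_of_notMem hq x)
        simp
  · obtain ⟨b, hb, hbU⟩ := Set.not_subset.mp h
    refine (Submodule.eq_bot_iff _).mpr fun φ hφ =>
      funext fun q => LinearMap.ext fun x => Subtype.ext ?_
    by_cases hq : q ∈ U'
    · rw [coe_apply_eq_mul_scl φ hq, scl_eq_scl hQ hU' hU hφ hq hb, scl,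
        coe_eq_zero_of_notMem hbU, mul_zero]
      rfl
    · obtain rfl : x = 0 := Subtype.ext (coe_eq_zero_of_notMem hq x)
      simp
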